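/- There exists a universal constant C > 0 such that at every point of B_1 with z ≠ 0 the following hold: for all indices ℓ and j, |Σ_{i=1}^N (X_ℓ b_{ij}) X_iρ| ≤ C ψ; moreover Σ_{i,j=1}^N |(X_i b_{ij}) X_jρ| ≤ C μ and Σ_{i,j=1}^N |b_{ij} X_i X_j ρ| ≤ C μ. -/

import Mathlib

open MeasureTheory Real Set Filter Asymptotics

noncomputable section

/-- The underlying space ℝ^m × ℝ^k. -/
abbrev E (m k : ℕ) : Type :=
  EuclideanSpace ℝ (Fin m) × EuclideanSpace ℝ (Fin k)

namespace BG

variable {m k : ℕ}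

/-- The Baouendi–Grushin gauge ρ. -/
def rho (γ : ℝ) (p : E m k) : ℝ :=
  (‖p.1‖ ^ (2 * (γ + 1)) + (γ + 1) ^ 2 * ‖p.2‖ ^ 2) ^ (1 / (2 * (γ + 1)))

/-- The angle function ψ = |z|^{2γ}/ρ^{2γ}. -/
def psi (γ : ℝ) (p : E m k) : ℝ :=
  ‖p.1‖ ^ (2 * γ) / rho γ p ^ (2 * γ)

/-- The gauge ball B_r = {ρ < r}. -/
def ball (γ r : ℝ) : Set (E m k) := {p | rho γ p < r}

/-- The Baouendi–Grushin vector fields as direction fields: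
X_i = ∂_{z_i} for i < m, X_{m+j} = |z|^γ ∂_{t_j}. -/
def Xvec (γ : ℝ) (p : E m k) (i : Fin (m + k)) : E m k :=
  if h : (i : ℕ) < m then (EuclideanSpace.single ⟨(i : ℕ), h⟩ 1, 0)
  else (0, EuclideanSpace.single ⟨(i : ℕ) - m, by have := i.isLt; omega⟩ (‖p.1‖ ^ γ))

/-- Derivative along the i-th Baouendi–Grushin vector field. -/
def Xd (γ : ℝ) (i : Fin (m + k)) (f : E m k → ℝ) (p : E m k) : ℝ :=
  fderiv ℝ f p (Xvec γ p i)

/-- The quadratic form ⟨A Xu, Xu⟩. -/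
def quadA (γ : ℝ) (A : E m k → Matrix (Fin (m + k)) (Fin (m + k)) ℝ)
    (u : E m k → ℝ) (p : E m k) : ℝ :=
  ∑ i, ∑ j, A p i j * Xd γ i u p * Xd γ j u p

/-- μ = ⟨A Xρ, Xρ⟩. -/
def mu (γ : ℝ) (A : E m k → Matrix (Fin (m + k)) (Fin (m + k)) ℝ) (p : E m k) : ℝ :=
  quadA γ A (rho γ) p

/-- The operator 𝓛 u = Σ_{i,j} X_i(a_{ij} X_j u). -/
def Lop (γ : ℝ) (A : E m k → Matrix (Fin (m + k)) (Fin (m + k)) ℝ)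
    (u : E m k → ℝ) (p : E m k) : ℝ :=
  ∑ i, ∑ j, Xd γ i (fun q => A q i j * Xd γ j u q) p

/-- The vector field F = (ρ/μ) Σ a_{ij} X_iρ X_j, as a first order operator. -/
def Fop (γ : ℝ) (A : E m k → Matrix (Fin (m + k)) (Fin (m + k)) ℝ)
    (v : E m k → ℝ) (p : E m k) : ℝ :=
  rho γ p / mu γ A p * ∑ i, ∑ j, A p i j * Xd γ i (rho γ) p * Xd γ j v p

/-- The Baouendi–Grushin operator 𝓑_γ = Δ_z + |z|^{2γ} Δ_t = Σ_i X_i X_i. -/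
def Bop (γ : ℝ) (u : E m k → ℝ) (p : E m k) : ℝ :=
  ∑ i : Fin (m + k), Xd γ i (Xd γ i u) p

/-- The generator of anisotropic dilations Z = Σ z_i ∂_{z_i} + (γ+1) Σ t_j ∂_{t_j},
as a first order operator: the derivative in the direction (z, (γ+1) t). -/
def Zd (γ : ℝ) (v : E m k → ℝ) (p : E m k) : ℝ :=
  fderiv ℝ v p (p.1, (γ + 1) • p.2)

/-- The Euclidean divergence of a vector field on ℝ^m × ℝ^k. -/
def divV (V : E m k → E m k) (p : E m k) : ℝ :=
  (∑ i : Fin m, (fderiv ℝ V p (EuclideanSpace.single i 1, 0)).1 i) +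
    ∑ j : Fin k,
      (fderiv ℝ V p ((0 : EuclideanSpace ℝ (Fin m)), EuclideanSpace.single j 1)).2 j

/-- Uniform ellipticity: λ|η|² ≤ ⟨Aη,η⟩ ≤ λ⁻¹|η|². -/
def Elliptic (lam : ℝ) (A : E m k → Matrix (Fin (m + k)) (Fin (m + k)) ℝ) : Prop :=
  ∀ (p : E m k) (η : Fin (m + k) → ℝ),
    lam * ∑ i, η i ^ 2 ≤ ∑ i, ∑ j, A p i j * η i * η j ∧
      ∑ i, ∑ j, A p i j * η i * η j ≤ lam⁻¹ * ∑ i, η i ^ 2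

/-- Symmetry of the matrix A. -/
def Symm (A : E m k → Matrix (Fin (m + k)) (Fin (m + k)) ℝ) : Prop :=
  ∀ p i j, A p i j = A p j i

/-- The entries of A are C¹. -/
def C1coeff (A : E m k → Matrix (Fin (m + k)) (Fin (m + k)) ℝ) : Prop :=
  ∀ i j, ContDiff ℝ 1 fun p => A p i j

/-- The structural hypothesis (H) on B = A - I, in B_1. -/
def HypH (γ Λ : ℝ) (A : E m k → Matrix (Fin (m + k)) (Fin (m + k)) ℝ) : Prop :=
  ∀ p ∈ ball (m := m) (k := k) γ 1,
    (∀ i j : Fin (m + k),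
        |(A p - 1) i j| ≤
          if (i : ℕ) < m ∧ (j : ℕ) < m then Λ * rho γ p
          else Λ * psi γ p ^ ((1 : ℝ) / 2 + 1 / (2 * γ)) * rho γ p) ∧
      ∀ l i j : Fin (m + k),
        |Xd γ l (fun q => (A q - 1) i j) p| ≤
          if (l : ℕ) < m ∧ (i : ℕ) < m ∧ (j : ℕ) < m then Λ
          else if m ≤ (l : ℕ) ∧ (m ≤ (i : ℕ) ∨ m ≤ (j : ℕ)) then
            Λ * psi γ p ^ ((1 : ℝ) + 1 / (2 * γ))
          else Λ * psi γ p ^ ((1 : ℝ) / 2)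

end BG

namespace BG
variable {m k : ℕ}

lemma Xvec_castAdd (γ : ℝ) (p : E m k) (i : Fin m) :
    Xvec γ p (Fin.castAdd k i) = (EuclideanSpace.single i 1, 0) := by
  simp [Xvec]

lemma Xvec_natAdd (γ : ℝ) (p : E m k) (i : Fin k) :
    Xvec γ p (Fin.natAdd m i) = (0, EuclideanSpace.single i (‖p.1‖ ^ γ)) := by
  simp [Xvec]

lemma hasFDerivAt_normz (a : ℝ) (p : E m k) (hp : p.1 ≠ 0) :
    HasFDerivAt (fun q : E m k => ‖q.1‖ ^ a)
      ((a * ‖p.1‖ ^ (a - 2)) • (innerSL ℝ p.1).comp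
        (ContinuousLinearMap.fst ℝ (EuclideanSpace ℝ (Fin m)) (EuclideanSpace ℝ (Fin k)))) p := by
  have h1 : HasFDerivAt (fun q : E m k => q.1) (ContinuousLinearMap.fst ℝ _ _) p := hasFDerivAt_fst
  have h2 := h1.norm_sq
  have hr : 0 < ‖p.1‖ := norm_pos_iff.mpr hp
  have h3 := h2.rpow_const (p := a / 2) (Or.inl (by positivity))
  have e : ∀ (x b : ℝ), 0 ≤ x → (x ^ 2) ^ b = x ^ (2 * b) := by
    intro x b hx
    rw [← Real.rpow_natCast, ← Real.rpow_mul hx]; norm_num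
  have e0 : (fun q : E m k => ‖q.1‖ ^ a) = fun q : E m k => (‖q.1‖ ^ 2) ^ (a / 2) := by
    funext q
    rw [e _ _ (norm_nonneg _)]; congr 1; ring
  rw [e0]
  refine h3.congr_fderiv ?_
  rw [e _ _ (norm_nonneg _), show 2 * (a / 2 - 1) = a - 2 by ring]
  ext v <;> simp <;> ring

def w (γ : ℝ) (p : E m k) : ℝ := ‖p.1‖ ^ (2 * (γ + 1)) + (γ + 1) ^ 2 * ‖p.2‖ ^ 2

lemma w_pos {γ : ℝ} (hγ : 0 < γ) (p : E m k) (hp : p.1 ≠ 0) : 0 < w γ p := by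
  have hr : 0 < ‖p.1‖ := norm_pos_iff.mpr hp
  unfold w; positivity

lemma rho_pos {γ : ℝ} (hγ : 0 < γ) (p : E m k) (hp : p.1 ≠ 0) : 0 < rho γ p :=
  Real.rpow_pos_of_pos (w_pos hγ p hp) _

lemma rho_rpow {γ : ℝ} (hγ : 0 < γ) (p : E m k) (hp : p.1 ≠ 0) :
    rho γ p ^ (2 * (γ + 1)) = w γ p := by
  have : rho γ p = w γ p ^ (1 / (2 * (γ + 1))) := rfl
  rw [this, ← Real.rpow_mul (w_pos hγ p hp).le, one_div, inv_mul_cancel₀ (by positivity), Real.rpow_one]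

/-- The derivative of the gauge. -/
def dR (γ : ℝ) (p : E m k) : E m k →L[ℝ] ℝ :=
  (rho γ p ^ (-(2 * γ + 1))) •
    ((‖p.1‖ ^ (2 * γ)) • (innerSL ℝ p.1).comp (ContinuousLinearMap.fst ℝ _ _) +
      (γ + 1) • (innerSL ℝ p.2).comp (ContinuousLinearMap.snd ℝ _ _))

lemma hasFDerivAt_rho {γ : ℝ} (hγ : 0 < γ) (p : E m k) (hp : p.1 ≠ 0) :
    HasFDerivAt (rho γ) (dR γ p) p := by
  have h1 := hasFDerivAt_normz (2 * (γ + 1)) p hp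
  have h2 : HasFDerivAt (fun q : E m k => q.2) (ContinuousLinearMap.snd ℝ _ _) p := hasFDerivAt_snd
  have h3 := (h1.add (h2.norm_sq.const_mul ((γ + 1) ^ 2))).rpow_const (p := 1 / (2 * (γ + 1)))
    (Or.inl (w_pos hγ p hp).ne')
  refine h3.congr_fderiv ?_
  have hw := w_pos hγ p hp
  have e : rho γ p ^ (-(2 * γ + 1)) = w γ p ^ (1 / (2 * (γ + 1)) - 1) := by
    have : rho γ p = w γ p ^ (1 / (2 * (γ + 1))) := rfl
    rw [this, ← Real.rpow_mul hw.le]; congr 1; field_simp; ring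
  have e2 : 2 * (γ + 1) - 2 = 2 * γ := by ring
  unfold dR
  rw [e, e2]
  change (1 / (2 * (γ + 1)) * w γ p ^ (1 / (2 * (γ + 1)) - 1)) • _ = _
  generalize w γ p ^ (1 / (2 * (γ + 1)) - 1) = W
  have : γ + 1 ≠ 0 := by positivity
  ext v <;> simp <;> field_simp

lemma dR_z (γ : ℝ) (p : E m k) (i : Fin m) : dR γ p (Xvec γ p (Fin.castAdd k i)) =
    p.1 i * ‖p.1‖ ^ (2 * γ) * rho γ p ^ (-(2 * γ + 1)) := by
  rw [Xvec_castAdd]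
  simp [dR, EuclideanSpace.inner_single_right]; ring

lemma dR_t (γ : ℝ) (p : E m k) (i : Fin k) : dR γ p (Xvec γ p (Fin.natAdd m i)) =
    ‖p.1‖ ^ γ * ((γ + 1) * p.2 i) * rho γ p ^ (-(2 * γ + 1)) := by
  rw [Xvec_natAdd]
  simp [dR, EuclideanSpace.inner_single_right]; ring

lemma Xd_rho {γ : ℝ} (hγ : 0 < γ) (p : E m k) (hp : p.1 ≠ 0) (i : Fin (m + k)) :
    Xd γ i (rho γ) p = dR γ p (Xvec γ p i) := by
  unfold Xd; rw [(hasFDerivAt_rho hγ p hp).fderiv]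

/-- second derivative, z-component -/
lemma Xd_Xd_z {γ : ℝ} (hγ : 0 < γ) (p : E m k) (hp : p.1 ≠ 0) (i : Fin (m + k)) (j : Fin m) :
    Xd γ i (Xd γ (Fin.castAdd k j) (rho γ)) p =
      (Xvec γ p i).1 j * ‖p.1‖ ^ (2 * γ) * rho γ p ^ (-(2 * γ + 1)) +
      p.1 j * (2 * γ * ‖p.1‖ ^ (2 * γ - 2) * inner ℝ p.1 (Xvec γ p i).1) * rho γ p ^ (-(2 * γ + 1)) +
      p.1 j * ‖p.1‖ ^ (2 * γ) * (-(2 * γ + 1) * rho γ p ^ (-(2 * γ + 1) - 1) * dR γ p (Xvec γ p i)) := by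
  have ho : IsOpen {q : E m k | q.1 ≠ 0} := isOpen_ne_fun continuous_fst continuous_const
  have hev : Xd γ (Fin.castAdd k j) (rho γ) =ᶠ[nhds p]
      fun q => q.1 j * ‖q.1‖ ^ (2 * γ) * rho γ q ^ (-(2 * γ + 1)) := by
    filter_upwards [ho.mem_nhds hp] with q hq
    rw [Xd_rho hγ q hq, dR_z]
  have h1 : HasFDerivAt (fun q : E m k => q.1 j)
      ((EuclideanSpace.proj j).comp (ContinuousLinearMap.fst ℝ _ _)) p :=
    ((EuclideanSpace.proj j : EuclideanSpace ℝ (Fin m) →L[ℝ] ℝ).hasFDerivAt (x := p.1)).comp p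
      hasFDerivAt_fst
  have h := (h1.mul (hasFDerivAt_normz (2 * γ) p hp)).mul
    ((hasFDerivAt_rho hγ p hp).rpow_const (p := -(2 * γ + 1)) (Or.inl (rho_pos hγ p hp).ne'))
  unfold Xd at hev ⊢
  rw [hev.fderiv_eq]
  refine (congrArg (fun L : E m k →L[ℝ] ℝ => L (Xvec γ p i)) h.fderiv).trans ?_
  simp; ring

lemma Xd_Xd_t {γ : ℝ} (hγ : 0 < γ) (p : E m k) (hp : p.1 ≠ 0) (i : Fin (m + k)) (j : Fin k) :
    Xd γ i (Xd γ (Fin.natAdd m j) (rho γ)) p =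
      (γ * ‖p.1‖ ^ (γ - 2) * inner ℝ p.1 (Xvec γ p i).1) * ((γ + 1) * p.2 j) * rho γ p ^ (-(2 * γ + 1)) +
      ‖p.1‖ ^ γ * ((γ + 1) * (Xvec γ p i).2 j) * rho γ p ^ (-(2 * γ + 1)) +
      ‖p.1‖ ^ γ * ((γ + 1) * p.2 j) * (-(2 * γ + 1) * rho γ p ^ (-(2 * γ + 1) - 1) * dR γ p (Xvec γ p i)) := by
  have ho : IsOpen {q : E m k | q.1 ≠ 0} := isOpen_ne_fun continuous_fst continuous_const
  have hev : Xd γ (Fin.natAdd m j) (rho γ) =ᶠ[nhds p]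
      fun q => ‖q.1‖ ^ γ * ((γ + 1) * q.2 j) * rho γ q ^ (-(2 * γ + 1)) := by
    filter_upwards [ho.mem_nhds hp] with q hq
    rw [Xd_rho hγ q hq, dR_t]
  have h1 : HasFDerivAt (fun q : E m k => q.2 j)
      ((EuclideanSpace.proj j).comp (ContinuousLinearMap.snd ℝ _ _)) p :=
    ((EuclideanSpace.proj j : EuclideanSpace ℝ (Fin k) →L[ℝ] ℝ).hasFDerivAt (x := p.2)).comp p
      hasFDerivAt_snd
  have h := ((hasFDerivAt_normz γ p hp).mul (h1.const_mul (γ + 1))).mul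
    ((hasFDerivAt_rho hγ p hp).rpow_const (p := -(2 * γ + 1)) (Or.inl (rho_pos hγ p hp).ne'))
  unfold Xd at hev ⊢
  rw [hev.fderiv_eq]
  refine (congrArg (fun L : E m k →L[ℝ] ℝ => L (Xvec γ p i)) h.fderiv).trans ?_
  simp; ring

/-- the ratio |z|/ρ -/
def sr (γ : ℝ) (p : E m k) : ℝ := ‖p.1‖ / rho γ p

lemma sr_pos {γ : ℝ} (hγ : 0 < γ) (p : E m k) (hp : p.1 ≠ 0) : 0 < sr γ p :=
  div_pos (norm_pos_iff.mpr hp) (rho_pos hγ p hp)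

lemma sr_le {γ : ℝ} (hγ : 0 < γ) (p : E m k) (hp : p.1 ≠ 0) : sr γ p ≤ 1 := by
  have hR := rho_pos hγ p hp
  rw [sr, div_le_one hR]
  rw [← Real.rpow_le_rpow_iff (norm_nonneg _) hR.le (by positivity : 0 < 2 * (γ + 1)),
    rho_rpow hγ p hp]
  unfold w; nlinarith [sq_nonneg ((γ + 1) * ‖p.2‖)]

lemma psi_eq {γ : ℝ} (hγ : 0 < γ) (p : E m k) (hp : p.1 ≠ 0) : psi γ p = sr γ p ^ (2 * γ) := by
  rw [psi, sr, Real.div_rpow (norm_nonneg _) (rho_pos hγ p hp).le]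

lemma t_le {γ : ℝ} (hγ : 0 < γ) (p : E m k) (hp : p.1 ≠ 0) (j : Fin k) :
    |(γ + 1) * p.2 j| ≤ rho γ p ^ (γ + 1) := by
  have hR := rho_pos hγ p hp
  have h1 : |p.2 j| ≤ ‖p.2‖ := PiLp.norm_apply_le p.2 j
  have h2 : (rho γ p ^ (γ + 1)) ^ 2 = w γ p := by
    rw [← rho_rpow hγ p hp, ← Real.rpow_natCast, ← Real.rpow_mul hR.le]; congr 1; push_cast; ring
  have h3 : (γ + 1) * ‖p.2‖ ≤ rho γ p ^ (γ + 1) := by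
    apply le_of_sq_le_sq _ (by positivity)
    rw [h2]; unfold w
    have : 0 ≤ ‖p.1‖ ^ (2 * (γ + 1)) := by positivity
    nlinarith
  rw [abs_mul, abs_of_pos (by positivity : 0 < γ + 1)]
  nlinarith

lemma z_le (p : E m k) (j : Fin m) : |p.1 j| ≤ ‖p.1‖ := PiLp.norm_apply_le p.1 j

/-- a product of powers of |z| and ρ -/
lemma pw {γ : ℝ} (hγ : 0 < γ) (p : E m k) (hp : p.1 ≠ 0) (a b : ℝ) :
    ‖p.1‖ ^ a * rho γ p ^ b = sr γ p ^ a * rho γ p ^ (a + b) := by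
  have hR := rho_pos hγ p hp
  rw [sr, Real.div_rpow (norm_nonneg _) hR.le, Real.rpow_add hR]
  field_simp

lemma Xrho_sq {γ : ℝ} (hγ : 0 < γ) (p : E m k) (hp : p.1 ≠ 0) :
    ∑ i, (Xd γ i (rho γ) p) ^ 2 = psi γ p := by
  have hR := rho_pos hγ p hp
  have hr : 0 < ‖p.1‖ := norm_pos_iff.mpr hp
  simp only [Xd_rho hγ p hp]
  rw [Fin.sum_univ_add]
  simp only [dR_z, dR_t]
  have e1 : ∀ i : Fin m, (p.1 i * ‖p.1‖ ^ (2 * γ) * rho γ p ^ (-(2 * γ + 1))) ^ 2 =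
      (‖p.1‖ ^ (2 * γ) * rho γ p ^ (-(2 * γ + 1))) ^ 2 * (p.1 i) ^ 2 := fun i => by ring
  have e2 : ∀ i : Fin k, (‖p.1‖ ^ γ * ((γ + 1) * p.2 i) * rho γ p ^ (-(2 * γ + 1))) ^ 2 =
      (‖p.1‖ ^ γ * (γ + 1) * rho γ p ^ (-(2 * γ + 1))) ^ 2 * (p.2 i) ^ 2 := fun i => by ring
  simp only [e1, e2, ← Finset.mul_sum]
  rw [← EuclideanSpace.real_norm_sq_eq, ← EuclideanSpace.real_norm_sq_eq]
  have hw := rho_rpow hγ p hp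
  have e3 : ‖p.1‖ ^ (2 * (γ + 1)) = (‖p.1‖ ^ γ) ^ 2 * ‖p.1‖ ^ 2 := by
    rw [← Real.rpow_natCast, ← Real.rpow_natCast, ← Real.rpow_mul hr.le, ← Real.rpow_add hr]
    congr 1; push_cast; ring
  have e4 : ‖p.1‖ ^ (2 * γ) = (‖p.1‖ ^ γ) ^ 2 := by
    rw [← Real.rpow_natCast, ← Real.rpow_mul hr.le]
    congr 1; push_cast; ring
  have e5 : (rho γ p ^ (-(2 * γ + 1))) ^ 2 * rho γ p ^ (2 * (γ + 1)) = (rho γ p ^ (2 * γ))⁻¹ := by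
    rw [← Real.rpow_natCast, ← Real.rpow_mul hR.le, ← Real.rpow_add hR, ← Real.rpow_neg hR.le]
    congr 1; push_cast; ring
  rw [psi, div_eq_mul_inv, ← e5, hw, w, e3, e4]
  ring


section bounds

lemma sr_mono {γ : ℝ} (hγ : 0 < γ) (p : E m k) (hp : p.1 ≠ 0) {a b : ℝ} (h : a ≤ b) : sr γ p ^ b ≤ sr γ p ^ a :=
  Real.rpow_le_rpow_of_exponent_ge (sr_pos hγ p hp) (sr_le hγ p hp) h

lemma F1 {γ : ℝ} (hγ : 0 < γ) (p : E m k) (hp : p.1 ≠ 0) : ‖p.1‖ ^ (2 * γ) * rho γ p ^ (-(2 * γ + 1)) = sr γ p ^ (2 * γ) * (rho γ p)⁻¹ := by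
  rw [pw hγ p hp, ← Real.rpow_neg_one]; congr 2; ring

lemma F2 {γ : ℝ} (hγ : 0 < γ) (p : E m k) (hp : p.1 ≠ 0) : ‖p.1‖ ^ γ * rho γ p ^ (γ + 1) * rho γ p ^ (-(2 * γ + 1) - 1) =
    sr γ p ^ γ * (rho γ p)⁻¹ := by
  rw [mul_assoc, ← Real.rpow_add (rho_pos hγ p hp), pw hγ p hp, ← Real.rpow_neg_one]
  congr 2; ring

lemma F3 {γ : ℝ} (hγ : 0 < γ) (p : E m k) (hp : p.1 ≠ 0) : ‖p.1‖ * ‖p.1‖ ^ (2 * γ) * rho γ p ^ (-(2 * γ + 1) - 1) ≤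
    sr γ p ^ (2 * γ) * (rho γ p)⁻¹ := by
  have hR := rho_pos hγ p hp
  have hr : 0 < ‖p.1‖ := norm_pos_iff.mpr hp
  have e : ‖p.1‖ * ‖p.1‖ ^ (2 * γ) = ‖p.1‖ ^ (2 * γ + 1) := by
    rw [Real.rpow_add hr, Real.rpow_one]; ring
  rw [e, pw hγ p hp, show 2 * γ + 1 + (-(2 * γ + 1) - 1) = -1 by ring, Real.rpow_neg_one]
  have := sr_mono hγ p hp (show 2 * γ ≤ 2 * γ + 1 by linarith)
  gcongr

lemma X1_z {γ : ℝ} (hγ : 0 < γ) (p : E m k) (hp : p.1 ≠ 0) (i : Fin m) : |dR γ p (Xvec γ p (Fin.castAdd k i))| ≤ sr γ p ^ (2 * γ) := by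
  have hR := rho_pos hγ p hp
  rw [dR_z, mul_assoc, F1 hγ p hp, abs_mul, abs_of_pos (a := sr γ p ^ (2 * γ) * (rho γ p)⁻¹)
    (by have := sr_pos hγ p hp; positivity)]
  have h1 : |p.1 i| ≤ rho γ p :=
    (z_le p i).trans ((div_le_one hR).mp (sr_le hγ p hp))
  have hs : 0 < sr γ p ^ (2 * γ) := Real.rpow_pos_of_pos (sr_pos hγ p hp) _
  calc _ ≤ rho γ p * (sr γ p ^ (2 * γ) * (rho γ p)⁻¹) := by gcongr
    _ = _ := by field_simp

lemma X1_t {γ : ℝ} (hγ : 0 < γ) (p : E m k) (hp : p.1 ≠ 0) (i : Fin k) : |dR γ p (Xvec γ p (Fin.natAdd m i))| ≤ sr γ p ^ γ := by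
  have hR := rho_pos hγ p hp
  have hr : 0 < ‖p.1‖ := norm_pos_iff.mpr hp
  rw [dR_t, abs_mul, abs_mul, abs_of_pos (a := ‖p.1‖ ^ γ) (by positivity),
    abs_of_pos (a := rho γ p ^ _) (by positivity)]
  calc _ ≤ ‖p.1‖ ^ γ * rho γ p ^ (γ + 1) * rho γ p ^ (-(2 * γ + 1)) := by
        gcongr; exact t_le hγ p hp i
    _ = _ := by
        rw [mul_assoc, ← Real.rpow_add hR, pw hγ p hp,
          show γ + (γ + 1 + -(2 * γ + 1)) = 0 by ring, Real.rpow_zero, mul_one]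

lemma third_z {γ : ℝ} (hγ : 0 < γ) (p : E m k) (hp : p.1 ≠ 0) (j : Fin m) (d D : ℝ) (hd : |d| ≤ D) :
    |p.1 j * ‖p.1‖ ^ (2 * γ) * (-(2 * γ + 1) * rho γ p ^ (-(2 * γ + 1) - 1) * d)| ≤
      (2 * γ + 1) * (sr γ p ^ (2 * γ) * (rho γ p)⁻¹) * D := by
  have hR := rho_pos hγ p hp
  have hr : 0 < ‖p.1‖ := norm_pos_iff.mpr hp
  have hs := sr_pos hγ p hp
  simp only [abs_mul, abs_neg]
  rw [abs_of_pos (a := ‖p.1‖ ^ (2 * γ)) (by positivity),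
    abs_of_pos (a := rho γ p ^ _) (by positivity), abs_of_pos (a := 2 * γ + 1) (by positivity)]
  calc _ = (2 * γ + 1) * (|p.1 j| * ‖p.1‖ ^ (2 * γ) * rho γ p ^ (-(2 * γ + 1) - 1)) * |d| := by ring
    _ ≤ (2 * γ + 1) * (‖p.1‖ * ‖p.1‖ ^ (2 * γ) * rho γ p ^ (-(2 * γ + 1) - 1)) * D := by
      gcongr; exact z_le p j
    _ ≤ _ := by
      have := F3 hγ p hp
      have := (abs_nonneg d).trans hd
      gcongr

lemma third_t {γ : ℝ} (hγ : 0 < γ) (p : E m k) (hp : p.1 ≠ 0) (j : Fin k) (d D : ℝ) (hd : |d| ≤ D) :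
    |‖p.1‖ ^ γ * ((γ + 1) * p.2 j) * (-(2 * γ + 1) * rho γ p ^ (-(2 * γ + 1) - 1) * d)| ≤
      (2 * γ + 1) * (sr γ p ^ γ * (rho γ p)⁻¹) * D := by
  have hR := rho_pos hγ p hp
  have hr : 0 < ‖p.1‖ := norm_pos_iff.mpr hp
  have hs := sr_pos hγ p hp
  have ht := t_le hγ p hp j
  generalize (γ + 1) * p.2 j = T at ht ⊢
  simp only [abs_mul, abs_neg]
  rw [abs_of_pos (a := ‖p.1‖ ^ γ) (by positivity),
    abs_of_pos (a := rho γ p ^ _) (by positivity), abs_of_pos (a := 2 * γ + 1) (by positivity),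
    ← F2 hγ p hp]
  calc _ = (2 * γ + 1) * (‖p.1‖ ^ γ * |T| * rho γ p ^ (-(2 * γ + 1) - 1)) * |d| := by ring
    _ ≤ _ := by gcongr

lemma single_abs {n : ℕ} (i j : Fin n) (a : ℝ) :
    |(EuclideanSpace.single i a : EuclideanSpace ℝ (Fin n)) j| ≤ |a| := by
  rw [PiLp.single_apply]; split_ifs <;> simp

lemma X2_zz {γ : ℝ} (hγ : 0 < γ) (p : E m k) (hp : p.1 ≠ 0) (i j : Fin m) :
    |Xd γ (Fin.castAdd k i) (Xd γ (Fin.castAdd k j) (rho γ)) p| ≤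
      (4 * γ + 2) * (sr γ p ^ (2 * γ) * (rho γ p)⁻¹) := by
  have hR := rho_pos hγ p hp
  have hr : 0 < ‖p.1‖ := norm_pos_iff.mpr hp
  have hs := sr_pos hγ p hp
  rw [Xd_Xd_z hγ p hp]
  have h3 := third_z hγ p hp j _ 1 ((X1_z hγ p hp i).trans
    (Real.rpow_le_one hs.le (sr_le hγ p hp) (by positivity)))
  have h1 : |(Xvec γ p (Fin.castAdd k i)).1 j * ‖p.1‖ ^ (2 * γ) * rho γ p ^ (-(2 * γ + 1))| ≤
      sr γ p ^ (2 * γ) * (rho γ p)⁻¹ := by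
    rw [mul_assoc, F1 hγ p hp, abs_mul, abs_of_pos (a := _ * (rho γ p)⁻¹) (by positivity)]
    have : |(Xvec γ p (Fin.castAdd k i)).1 j| ≤ 1 := by
      rw [Xvec_castAdd]; simpa using single_abs i j 1
    exact mul_le_of_le_one_left (by positivity) this
  have h2 : |p.1 j * (2 * γ * ‖p.1‖ ^ (2 * γ - 2) * inner ℝ p.1 (Xvec γ p (Fin.castAdd k i)).1) *
      rho γ p ^ (-(2 * γ + 1))| ≤ 2 * γ * (sr γ p ^ (2 * γ) * (rho γ p)⁻¹) := by
    have e : inner ℝ p.1 (Xvec γ p (Fin.castAdd k i)).1 = p.1 i := by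
      rw [Xvec_castAdd]; simp [EuclideanSpace.inner_single_right]
    rw [e, ← F1 hγ p hp]
    simp only [abs_mul]
    rw [abs_of_pos (a := ‖p.1‖ ^ (2 * γ - 2)) (by positivity), abs_of_pos hγ, abs_two,
      abs_of_pos (a := rho γ p ^ _) (by positivity)]
    have e2 : ‖p.1‖ ^ (2 * γ) = ‖p.1‖ * ‖p.1‖ ^ (2 * γ - 2) * ‖p.1‖ := by
      rw [Real.rpow_sub hr, Real.rpow_two]; field_simp
    rw [e2]
    calc _ ≤ ‖p.1‖ * (2 * γ * ‖p.1‖ ^ (2 * γ - 2) * ‖p.1‖) * rho γ p ^ (-(2 * γ + 1)) := by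
          gcongr
          · exact z_le p j
          · exact z_le p i
      _ = _ := by ring
  refine (abs_add_three _ _ _).trans ?_
  linarith

lemma X2_tz {γ : ℝ} (hγ : 0 < γ) (p : E m k) (hp : p.1 ≠ 0) (i : Fin k) (j : Fin m) :
    |Xd γ (Fin.natAdd m i) (Xd γ (Fin.castAdd k j) (rho γ)) p| ≤
      (4 * γ + 2) * (sr γ p ^ (γ - 1) * (rho γ p)⁻¹) := by
  have hR := rho_pos hγ p hp
  have hs := sr_pos hγ p hp
  rw [Xd_Xd_z hγ p hp]
  have h3 := third_z hγ p hp j _ 1 ((X1_t hγ p hp i).trans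
    (Real.rpow_le_one hs.le (sr_le hγ p hp) (by positivity)))
  have e : (Xvec γ p (Fin.natAdd m i)).1 = 0 := by rw [Xvec_natAdd]
  rw [e]
  simp only [inner_zero_right, PiLp.zero_apply, mul_zero, zero_mul, zero_add]
  have h4 : sr γ p ^ (2 * γ) * (rho γ p)⁻¹ ≤ sr γ p ^ (γ - 1) * (rho γ p)⁻¹ := by
    have := sr_mono hγ p hp (show γ - 1 ≤ 2 * γ by linarith)
    gcongr
  have h5 : 0 < sr γ p ^ (γ - 1) * (rho γ p)⁻¹ := by positivity
  refine h3.trans ?_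
  nlinarith

lemma X2_zt {γ : ℝ} (hγ : 0 < γ) (p : E m k) (hp : p.1 ≠ 0) (i : Fin m) (j : Fin k) :
    |Xd γ (Fin.castAdd k i) (Xd γ (Fin.natAdd m j) (rho γ)) p| ≤
      (4 * γ + 2) * (sr γ p ^ (γ - 1) * (rho γ p)⁻¹) := by
  have hR := rho_pos hγ p hp
  have hr : 0 < ‖p.1‖ := norm_pos_iff.mpr hp
  have hs := sr_pos hγ p hp
  rw [Xd_Xd_t hγ p hp]
  have h3 := third_t hγ p hp j _ 1 ((X1_z hγ p hp i).trans
    (Real.rpow_le_one hs.le (sr_le hγ p hp) (by positivity)))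
  have e : (Xvec γ p (Fin.castAdd k i)).2 = 0 := by rw [Xvec_castAdd]
  have e' : inner ℝ p.1 (Xvec γ p (Fin.castAdd k i)).1 = p.1 i := by
    rw [Xvec_castAdd]; simp [EuclideanSpace.inner_single_right]
  have h4 : sr γ p ^ γ * (rho γ p)⁻¹ ≤ sr γ p ^ (γ - 1) * (rho γ p)⁻¹ := by
    have := sr_mono hγ p hp (show γ - 1 ≤ γ by linarith)
    gcongr
  have h5 : 0 < sr γ p ^ (γ - 1) * (rho γ p)⁻¹ := by positivity
  have h2 : |(γ * ‖p.1‖ ^ (γ - 2) * inner ℝ p.1 (Xvec γ p (Fin.castAdd k i)).1) * ((γ + 1) * p.2 j) *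
      rho γ p ^ (-(2 * γ + 1))| ≤ γ * (sr γ p ^ (γ - 1) * (rho γ p)⁻¹) := by
    have ht := t_le hγ p hp j
    rw [e']
    generalize (γ + 1) * p.2 j = T at ht ⊢
    simp only [abs_mul]
    rw [abs_of_pos (a := ‖p.1‖ ^ (γ - 2)) (by positivity), abs_of_pos hγ,
      abs_of_pos (a := rho γ p ^ _) (by positivity)]
    calc _ ≤ (γ * ‖p.1‖ ^ (γ - 2) * ‖p.1‖) * rho γ p ^ (γ + 1) * rho γ p ^ (-(2 * γ + 1)) := by
          gcongr
          exact z_le p i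
      _ = γ * ((‖p.1‖ ^ (γ - 2) * ‖p.1‖ ^ (1 : ℝ)) *
            (rho γ p ^ (γ + 1) * rho γ p ^ (-(2 * γ + 1)))) := by rw [Real.rpow_one]; ring
      _ = _ := by
          rw [← Real.rpow_add hr, ← Real.rpow_add hR, pw hγ p hp, ← Real.rpow_neg_one]
          congr 3 <;> ring
  rw [e]
  simp only [PiLp.zero_apply, mul_zero, zero_mul, add_zero]
  refine (abs_add_le _ _).trans ?_
  nlinarith

lemma X2_tt {γ : ℝ} (hγ : 0 < γ) (p : E m k) (hp : p.1 ≠ 0) (i j : Fin k) :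
    |Xd γ (Fin.natAdd m i) (Xd γ (Fin.natAdd m j) (rho γ)) p| ≤
      (4 * γ + 2) * (sr γ p ^ (2 * γ) * (rho γ p)⁻¹) := by
  have hR := rho_pos hγ p hp
  have hr : 0 < ‖p.1‖ := norm_pos_iff.mpr hp
  have hs := sr_pos hγ p hp
  rw [Xd_Xd_t hγ p hp]
  have h3 := third_t hγ p hp j _ _ (X1_t hγ p hp i)
  have e : (Xvec γ p (Fin.natAdd m i)).1 = 0 := by rw [Xvec_natAdd]
  have h5 : 0 < sr γ p ^ (2 * γ) * (rho γ p)⁻¹ := by positivity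
  have e6 : sr γ p ^ (2 * γ) = sr γ p ^ γ * sr γ p ^ γ := by
    rw [← Real.rpow_add hs]; congr 1; ring
  have e7 : ‖p.1‖ ^ (2 * γ) = ‖p.1‖ ^ γ * ‖p.1‖ ^ γ := by
    rw [← Real.rpow_add hr]; congr 1; ring
  have h1 : |‖p.1‖ ^ γ * ((γ + 1) * (Xvec γ p (Fin.natAdd m i)).2 j) * rho γ p ^ (-(2 * γ + 1))| ≤
      (γ + 1) * (sr γ p ^ (2 * γ) * (rho γ p)⁻¹) := by
    have : |(Xvec γ p (Fin.natAdd m i)).2 j| ≤ ‖p.1‖ ^ γ := by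
      rw [Xvec_natAdd]
      refine (single_abs i j _).trans (abs_of_pos (by positivity)).le
    rw [← F1 hγ p hp, e7]
    simp only [abs_mul]
    rw [abs_of_pos (a := ‖p.1‖ ^ γ) (by positivity), abs_of_pos (a := γ + 1) (by positivity),
      abs_of_pos (a := rho γ p ^ _) (by positivity)]
    calc _ ≤ ‖p.1‖ ^ γ * ((γ + 1) * ‖p.1‖ ^ γ) * rho γ p ^ (-(2 * γ + 1)) := by gcongr
      _ = _ := by ring
  have e8 : (2 * γ + 1) * (sr γ p ^ γ * (rho γ p)⁻¹) * sr γ p ^ γ =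
      (2 * γ + 1) * (sr γ p ^ (2 * γ) * (rho γ p)⁻¹) := by rw [e6]; ring
  rw [e8] at h3
  rw [e]
  simp only [inner_zero_right, mul_zero, zero_mul, zero_add]
  refine (abs_add_le _ _).trans ?_
  nlinarith

/-- Every product of a derivative of `b_{ij}` with a component of `Xρ`. -/
lemma prod1 {γ : ℝ} (hγ : 0 < γ) (p : E m k) (hp : p.1 ≠ 0) (Λ : ℝ) (hΛ : 0 < Λ) (b : ℝ)
    (i : Fin (m + k)) (h1 : |b| ≤ Λ) (h2 : m ≤ (i : ℕ) → |b| ≤ Λ * sr γ p ^ γ) :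
    |b * Xd γ i (rho γ) p| ≤ Λ * psi γ p := by
  have hs := sr_pos hγ p hp
  have e6 : sr γ p ^ (2 * γ) = sr γ p ^ γ * sr γ p ^ γ := by
    rw [← Real.rpow_add hs]; congr 1; ring
  rw [Xd_rho hγ p hp, psi_eq hγ p hp, abs_mul]
  revert h2
  refine Fin.addCases (fun i h2 => ?_) (fun i h2 => ?_) i
  · have := X1_z hγ p hp i
    gcongr
  · have := X1_t hγ p hp i
    have h2 := h2 (by simp)
    rw [e6, ← mul_assoc]
    gcongr

lemma db_bounds {γ : ℝ} (hγ : 0 < γ) (p : E m k) (hp : p.1 ≠ 0) (Λ : ℝ) (hΛ : 0 < Λ)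
    (A : E m k → Matrix (Fin (m + k)) (Fin (m + k)) ℝ) (hA : HypH γ Λ A)
    (hb : p ∈ ball (m := m) (k := k) γ 1) (l i j : Fin (m + k)) :
    |Xd γ l (fun q => (A q - 1) i j) p| ≤ Λ ∧
    (m ≤ (i : ℕ) ∨ m ≤ (j : ℕ) →
      |Xd γ l (fun q => (A q - 1) i j) p| ≤ Λ * sr γ p ^ γ) := by
  have hs := sr_pos hγ p hp
  have h := (hA p hb).2 l i j
  have e1 : psi γ p ^ ((1 : ℝ) / 2) = sr γ p ^ γ := by
    rw [psi_eq hγ p hp, ← Real.rpow_mul hs.le]; congr 1; ring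
  have e2 : psi γ p ^ ((1 : ℝ) + 1 / (2 * γ)) ≤ sr γ p ^ γ := by
    rw [psi_eq hγ p hp, ← Real.rpow_mul hs.le]
    apply sr_mono hγ p hp
    have : 2 * γ * (1 + 1 / (2 * γ)) = 2 * γ + 1 := by field_simp
    linarith
  have e3 : sr γ p ^ γ ≤ 1 := Real.rpow_le_one hs.le (sr_le hγ p hp) hγ.le
  rw [e1] at h
  have e4 : Λ * sr γ p ^ γ ≤ Λ := mul_le_of_le_one_right hΛ.le e3
  have e5 : Λ * psi γ p ^ ((1 : ℝ) + 1 / (2 * γ)) ≤ Λ * sr γ p ^ γ := by gcongr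
  split_ifs at h with c1 c2
  · exact ⟨h, fun h' => by omega⟩
  · exact ⟨by linarith, fun _ => by linarith⟩
  · exact ⟨by linarith, fun _ => by linarith⟩

lemma prod2 {γ : ℝ} (hγ : 0 < γ) (p : E m k) (hp : p.1 ≠ 0) (Λ : ℝ) (hΛ : 0 < Λ)
    (A : E m k → Matrix (Fin (m + k)) (Fin (m + k)) ℝ) (hA : HypH γ Λ A)
    (hb : p ∈ ball (m := m) (k := k) γ 1) (i j : Fin (m + k)) :
    |(A p - 1) i j * Xd γ i (Xd γ j (rho γ)) p| ≤ Λ * (4 * γ + 2) * psi γ p := by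
  have hs := sr_pos hγ p hp
  have hR := rho_pos hγ p hp
  have h := (hA p hb).1 i j
  have e1 : psi γ p ^ ((1 : ℝ) / 2 + 1 / (2 * γ)) = sr γ p ^ (γ + 1) := by
    rw [psi_eq hγ p hp, ← Real.rpow_mul hs.le]; congr 1; field_simp
  have e3 : sr γ p ^ (γ + 1) ≤ 1 := Real.rpow_le_one hs.le (sr_le hγ p hp) (by linarith)
  have e4 : sr γ p ^ (γ + 1) * sr γ p ^ (γ - 1) = sr γ p ^ (2 * γ) := by
    rw [← Real.rpow_add hs]; congr 1; ring
  rw [e1] at h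
  rw [abs_mul, psi_eq hγ p hp]
  generalize (A p - 1) i j = b at h ⊢
  have key1 : ∀ D : ℝ, |b| ≤ Λ * rho γ p → |D| ≤ (4 * γ + 2) * (sr γ p ^ (2 * γ) * (rho γ p)⁻¹) →
      |b| * |D| ≤ Λ * (4 * γ + 2) * sr γ p ^ (2 * γ) := by
    intro D hb hD
    calc _ ≤ (Λ * rho γ p) * ((4 * γ + 2) * (sr γ p ^ (2 * γ) * (rho γ p)⁻¹)) := by gcongr
      _ = _ := by field_simp
  have key2 : ∀ D : ℝ, |b| ≤ Λ * sr γ p ^ (γ + 1) * rho γ p →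
      |D| ≤ (4 * γ + 2) * (sr γ p ^ (γ - 1) * (rho γ p)⁻¹) →
      |b| * |D| ≤ Λ * (4 * γ + 2) * sr γ p ^ (2 * γ) := by
    intro D hb hD
    rw [← e4]
    calc _ ≤ (Λ * sr γ p ^ (γ + 1) * rho γ p) *
          ((4 * γ + 2) * (sr γ p ^ (γ - 1) * (rho γ p)⁻¹)) := by gcongr
      _ = _ := by field_simp
  revert h
  refine Fin.addCases (fun i => ?_) (fun i => ?_) i <;>
    refine Fin.addCases (fun j h => ?_) (fun j h => ?_) j
  · exact key1 _ (by simpa using h) (X2_zz hγ p hp i j)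
  · exact key2 _ (by simpa using h) (X2_zt hγ p hp i j)
  · exact key2 _ (by simpa using h) (X2_tz hγ p hp i j)
  · refine key1 _ ?_ (X2_tt hγ p hp i j)
    have h : |b| ≤ Λ * sr γ p ^ (γ + 1) * rho γ p := by simpa using h
    refine h.trans ?_
    have := mul_le_of_le_one_right hΛ.le e3
    gcongr

end bounds

end BG

open BG in
/-- the estimates of Remark `rmk3.7` of the paper. -/
theorem remark_estimates
    (m k : ℕ) (hm : 1 ≤ m) (hk : 1 ≤ k) (γ : ℝ) (hγ : 0 < γ)
    (lam Λ : ℝ) (hlam : 0 < lam) (hΛ : 0 < Λ) :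
    ∃ C > (0 : ℝ),
      ∀ A : E m k → Matrix (Fin (m + k)) (Fin (m + k)) ℝ,
        C1coeff A → Symm A → Elliptic lam A → A 0 = 1 → HypH γ Λ A →
        ∀ p ∈ ball (m := m) (k := k) γ 1, p.1 ≠ 0 →
          (∀ l j : Fin (m + k),
              |∑ i, Xd γ l (fun q => (A q - 1) i j) p * Xd γ i (rho γ) p|
                ≤ C * psi γ p) ∧
            (∑ i, ∑ j, |Xd γ i (fun q => (A q - 1) i j) p * Xd γ j (rho γ) p|)
              ≤ C * mu γ A p ∧
            (∑ i, ∑ j, |(A p - 1) i j * Xd γ i (Xd γ j (rho γ)) p|)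
              ≤ C * mu γ A p := by
  set n : ℝ := ((m + k : ℕ) : ℝ) with hn
  have hn1 : 1 ≤ n := by rw [hn]; exact_mod_cast (by omega : 1 ≤ m + k)
  set K : ℝ := Λ * (4 * γ + 2) with hK
  have hK0 : 0 < K := by positivity
  have hΛK : Λ ≤ K := by rw [hK]; nlinarith
  have hC : 0 < n * n * K * (1 + lam⁻¹) := by positivity
  refine ⟨n * n * K * (1 + lam⁻¹), hC, ?_⟩
  intro A _ _ hell _ hA p hb hp
  have hpsi : 0 < psi γ p := by
    rw [psi_eq hγ p hp]; exact Real.rpow_pos_of_pos (sr_pos hγ p hp) _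
  have hmu : lam * psi γ p ≤ mu γ A p := by
    have := (hell p (fun i => Xd γ i (rho γ) p)).1
    rwa [Xrho_sq hγ p hp] at this
  have hmu0 : psi γ p ≤ lam⁻¹ * mu γ A p := by
    rw [inv_mul_eq_div, le_div_iff₀ hlam]; linarith
  have hmupos : 0 < mu γ A p := lt_of_lt_of_le (by positivity) hmu
  have hfin : n * n * K * psi γ p ≤ n * n * K * (1 + lam⁻¹) * mu γ A p := by
    rw [mul_assoc (n * n * K) (1 + lam⁻¹)]
    gcongr
    linarith
  have hsum : ∀ f : Fin (m + k) → Fin (m + k) → ℝ, (∀ i j, f i j ≤ K * psi γ p) →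
      ∑ i, ∑ j, f i j ≤ n * n * K * psi γ p := by
    intro f hf
    calc _ ≤ ∑ i : Fin (m + k), ∑ j : Fin (m + k), K * psi γ p :=
          Finset.sum_le_sum fun i _ => Finset.sum_le_sum fun j _ => hf i j
      _ = _ := by
          simp only [Finset.sum_const, Finset.card_univ, Fintype.card_fin, nsmul_eq_mul]
          rw [← hn]; ring
  have hΛpsi : Λ * psi γ p ≤ K * psi γ p := by gcongr
  refine ⟨fun l j => ?_, ?_, ?_⟩
  · refine (Finset.abs_sum_le_sum_abs _ _).trans ?_
    calc _ ≤ ∑ i : Fin (m + k), K * psi γ p := Finset.sum_le_sum fun i _ => by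
          obtain ⟨h1, h2⟩ := db_bounds hγ p hp Λ hΛ A hA hb l i j
          exact (prod1 hγ p hp Λ hΛ _ i h1 (fun h => h2 (Or.inl h))).trans hΛpsi
      _ = n * 1 * K * 1 * psi γ p := by
          simp only [Finset.sum_const, Finset.card_univ, Fintype.card_fin, nsmul_eq_mul]
          rw [← hn]; ring
      _ ≤ _ := by
          have : 1 ≤ 1 + lam⁻¹ := by have := inv_pos.mpr hlam; linarith
          gcongr
  · refine (hsum _ fun i j => ?_).trans hfin
    obtain ⟨h1, h2⟩ := db_bounds hγ p hp Λ hΛ A hA hb i i j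
    exact (prod1 hγ p hp Λ hΛ _ j h1 (fun h => h2 (Or.inr h))).trans hΛpsi
  · exact (hsum _ fun i j => prod2 hγ p hp Λ hΛ A hA hb i j).trans hfin
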